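/- Let w be a C∞-word of height k > 0, and let U = Ψ(w) be its left frontier and V = Ψ(w̃) its right frontier. Then: (1) w is left maximal if and only if U[i] ≠ 2 for every 1 ≤ i ≤ k−1; (2) w is left minimal if and only if U[i] ≠ 0 for every 1 ≤ i ≤ k−1; (3) w is right maximal if and only if V[i] ≠ 2 for every 1 ≤ i ≤ k−1; (4) w is right minimal if and only if V[i] ≠ 0 for every 1 ≤ i ≤ k−1. -/

import Mathlib

/- Common framework: words over the alphabet Σ = {1,2} (represented as natural
numbers), run-length encoding, the derivative D, k-differentiable words C^k,
C∞-words, heights, roots, primitives, minimal/maximal words, simple extensions,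
minimal forbidden words, and the left frontier Ψ. -/

namespace CinftyWords

/-- A word is a finite sequence of natural numbers. -/
abbrev Word := List ℕ

/-- `w` is a word over the alphabet Σ = {1,2}. -/
def IsWord (w : Word) : Prop := ∀ x ∈ w, x = 1 ∨ x = 2

/-- Complement of a letter: exchanges 1 and 2. -/
def bar (x : ℕ) : ℕ := 3 - x

/-- Letterwise complement of a word. -/
def comp (w : Word) : Word := w.map bar

/-- Run-length encoding Δ: the sequence of lengths of maximal runs of equal
consecutive letters. -/
def rle (w : Word) : Word := (w.splitBy (· == ·)).map List.length

/-- Drop the first run if it has length 1. -/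
def dropFirstRun1 (g : List (List ℕ)) : List (List ℕ) :=
  match g with
  | [] => []
  | r :: rs => if r.length = 1 then rs else r :: rs

/-- The derivative `D w`: the run-length encoding of the word obtained from `w`
by deleting its first and/or last run when that run has length 1. -/
def D (w : Word) : Word :=
  ((dropFirstRun1 ((dropFirstRun1 (w.splitBy (· == ·))).reverse)).reverse).map List.length

/-- `w` is differentiable: `w` is a word over Σ and so is its run-length encoding. -/
def Diffble (w : Word) : Prop := IsWord w ∧ IsWord (rle w)

/-- The set C^k of k-differentiable words: `D^[j] w` is differentiable for all `j < k`
(so that `D^[k] w` is defined). -/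
def CK (k : ℕ) : Set Word := {w | IsWord w ∧ ∀ j < k, Diffble (D^[j] w)}

/-- The set C∞ of words differentiable arbitrarily many times. -/
def Cinf : Set Word := {w | ∀ k : ℕ, w ∈ CK k}

/-- The height of a C∞-word: the least `k` with `D^[k] w = []`. -/
noncomputable def height (w : Word) : ℕ := sInf {k | D^[k] w = []}

/-- The root of a C∞-word: `D^[height w - 1] w`. -/
noncomputable def root (w : Word) : Word := D^[height w - 1] w

/-- `v` is a primitive of `w`: `v` is differentiable and `D v = w`. -/
def IsPrimitive (v w : Word) : Prop := Diffble v ∧ D v = w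

/-- A nonempty C∞-word is maximal if each `D^[j] w` (for `j ≤ height w - 2`) is a
primitive of `D^[j+1] w` of maximal length (vacuously true when `height w = 1`). -/
def MaximalWord (w : Word) : Prop :=
  w ∈ Cinf ∧ w ≠ [] ∧ ∀ j, j + 2 ≤ height w →
    ∀ v, IsPrimitive v (D^[j + 1] w) → v.length ≤ (D^[j] w).length

/-- A nonempty C∞-word is minimal if each `D^[j] w` (for `j ≤ height w - 2`) is a
primitive of `D^[j+1] w` of minimal length (vacuously true when `height w = 1`). -/
def MinimalWord (w : Word) : Prop :=
  w ∈ Cinf ∧ w ≠ [] ∧ ∀ j, j + 2 ≤ height w →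
    ∀ v, IsPrimitive v (D^[j + 1] w) → (D^[j] w).length ≤ v.length

/-- `w` is right maximal: a suffix of a maximal word. -/
def RightMaximal (w : Word) : Prop := ∃ v, MaximalWord v ∧ w <:+ v

/-- `w` is left maximal: a prefix of a maximal word. -/
def LeftMaximal (w : Word) : Prop := ∃ v, MaximalWord v ∧ w <+: v

/-- `w` is right minimal: a suffix of a minimal word. -/
def RightMinimal (w : Word) : Prop := ∃ v, MinimalWord v ∧ w <:+ v

/-- `w` is left minimal: a prefix of a minimal word. -/
def LeftMinimal (w : Word) : Prop := ∃ v, MinimalWord v ∧ w <+: v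

/-- `w` is right doubly extendable: both `w1` and `w2` are C∞-words. -/
def RightDoublyExt (w : Word) : Prop := w ++ [1] ∈ Cinf ∧ w ++ [2] ∈ Cinf

/-- `w` is left doubly extendable: both `1w` and `2w` are C∞-words. -/
def LeftDoublyExt (w : Word) : Prop := 1 :: w ∈ Cinf ∧ 2 :: w ∈ Cinf

/-- `w` is fully extendable: `1w1`, `1w2`, `2w1`, `2w2` are all C∞-words. -/
def FullyExt (w : Word) : Prop :=
  ∀ x, (x = 1 ∨ x = 2) → ∀ y, (y = 1 ∨ y = 2) → x :: (w ++ [y]) ∈ Cinf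

/-- `w'` is a right simple extension of `w`: `w' = w ++ s` is a C∞-word and at each
step the extension by the complementary letter is not a C∞-word. -/
def RightSimpleExt (w w' : Word) : Prop :=
  w' ∈ Cinf ∧ ∃ s : Word, IsWord s ∧ w' = w ++ s ∧
    ∀ i < s.length, w ++ s.take i ++ [bar (s.getD i 0)] ∉ Cinf

/-- `w'` is a left simple extension of `w`. -/
def LeftSimpleExt (w w' : Word) : Prop := RightSimpleExt w.reverse w'.reverse

/-- `w'` is a simple extension of `w`: a right simple extension of a left simple
extension of `w`. -/
def SimpleExt (w w' : Word) : Prop := ∃ v, LeftSimpleExt w v ∧ RightSimpleExt v w'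

/-- `m` is the maximal extension of `w`: a simple extension of `w` of maximal length. -/
def IsMaximalExtension (w m : Word) : Prop :=
  SimpleExt w m ∧ ∀ v, SimpleExt w v → v.length ≤ m.length

/-- A language is factorial if it is closed under taking factors. -/
def Factorial (F : Set Word) : Prop := ∀ v ∈ F, ∀ u, u <:+: v → u ∈ F

/-- A language is anti-factorial if no word of it is a proper factor of another
word of it. -/
def AntiFactorial (M : Set Word) : Prop := ∀ u ∈ M, ∀ v ∈ M, u ≠ v → ¬ u <:+: v

/-- The set of minimal forbidden words of a (factorial) language `F`: words not
in `F` whose maximal proper prefix and maximal proper suffix are both in `F`. -/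
def MF (F : Set Word) : Set Word := {v | v ∉ F ∧ v.dropLast ∈ F ∧ v.tail ∈ F}

/-- The height of a minimal forbidden word of C∞: `k + 1`, where `k` is the
(unique) integer such that `w` is k-differentiable and `D^[k] w ∈ {111, 222}`. -/
noncomputable def MFheight (w : Word) : ℕ :=
  sInf {k | w ∈ CK k ∧ (D^[k] w = [1, 1, 1] ∨ D^[k] w = [2, 2, 2])} + 1

/-- The left frontier Ψ of a C∞-word: the word of length `height w` over {0,1,2}
recording the first letter of each derivative, with `2` replaced by `0` when the
first two letters of the previous derivative are distinct. -/
noncomputable def psi (w : Word) : List ℕ :=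
  (List.range (height w)).map (fun i =>
    if i = 0 then w.getD 0 0
    else if (D^[i] w).getD 0 0 = 2 ∧ (D^[i - 1] w).getD 0 0 ≠ (D^[i - 1] w).getD 1 0 then 0
    else (D^[i] w).getD 0 0)

end CinftyWords

namespace CinftyWords

/-! ### Run expansion -/

/-- The word whose successive runs have the given lengths and which starts with the letter `y`. -/
def runs : ℕ → Word → Word
  | _, [] => []
  | y, n :: l => List.replicate n y ++ runs (bar y) l

/-- Drop the first letter if it is `1`. -/
def trimLeft : Word → Word
  | [] => []
  | n :: l => if n = 1 then l else n :: l

theorem bar_letter {y : ℕ} (hy : y = 1 ∨ y = 2) : bar y = 1 ∨ bar y = 2 := by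
  unfold bar; omega

theorem bar_ne (y : ℕ) : bar y ≠ y := by
  unfold bar; omega

theorem bar_bar {y : ℕ} (hy : y = 1 ∨ y = 2) : bar (bar y) = y := by
  unfold bar; omega

theorem length_runs (y : ℕ) (l : Word) : (runs y l).length = l.sum := by
  induction l generalizing y with
  | nil => rfl
  | cons n l ih => simp [runs, ih]

theorem IsWord.pos {l : Word} (h : IsWord l) : ∀ n ∈ l, 0 < n := fun n hn => by
  have := h n hn; omega

theorem isWord_runs {y : ℕ} (hy : y = 1 ∨ y = 2) (l : Word) : IsWord (runs y l) := by
  induction l generalizing y with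
  | nil => simp [runs, IsWord]
  | cons n l ih =>
    intro x hx
    rcases List.mem_append.1 hx with h | h
    · rwa [List.eq_of_mem_replicate h]
    · exact ih (bar_letter hy) x h

theorem head?_runs {y x : ℕ} {l : Word} (h : ∀ n ∈ l, 0 < n) (hx : x ∈ (runs y l).head?) :
    x = y := by
  cases l with
  | nil => simp [runs] at hx
  | cons n l =>
    obtain ⟨m, rfl⟩ : ∃ m, n = m + 1 := ⟨n - 1, by have := h n (by simp); omega⟩
    simpa [runs, List.replicate_succ, eq_comm] using hx

theorem rle_runs {y : ℕ} (hy : y = 1 ∨ y = 2) {l : Word} (h : ∀ n ∈ l, 0 < n) :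
    rle (runs y l) = l := by
  induction l generalizing y with
  | nil => simp [runs, rle]
  | cons n l ih =>
    have hn : n ≠ 0 := (h n (by simp)).ne'
    have hl : ∀ n ∈ l, 0 < n := fun m hm => h m (by simp [hm])
    have key : (runs y (n :: l)).splitBy (· == ·)
        = [List.replicate n y] ++ (runs (bar y) l).splitBy (· == ·) := by
      rw [runs, List.splitBy_append, List.splitBy_of_isChain]
      · simpa using hn
      · simp [List.isChain_replicate_of_rel]
      · intro x hx z hz
        rw [head?_runs hl hz,
          List.eq_of_mem_replicate (List.mem_of_mem_getLast? hx)]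
        simpa using (bar_ne y).symm
    have := ih (bar_letter hy) hl
    unfold rle at this ⊢
    rw [key, List.map_append, this]
    simp

theorem exists_runs {w : Word} (h : IsWord w) :
    ∃ y l, (y = 1 ∨ y = 2) ∧ (∀ n ∈ l, 0 < n) ∧ w = runs y l := by
  induction w with
  | nil => exact ⟨1, [], by simp, by simp, rfl⟩
  | cons a w ih =>
    have ha : a = 1 ∨ a = 2 := h a (by simp)
    obtain ⟨y, l, hy, hl, rfl⟩ := ih fun x hx => h x (by simp [hx])
    cases l with
    | nil => exact ⟨a, [1], ha, by simp, by simp [runs]⟩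
    | cons n l =>
      by_cases hya : y = a
      · subst hya
        refine ⟨y, (n + 1) :: l, hy, ?_, by simp [runs, List.replicate_succ]⟩
        simpa using fun m hm => hl m (by simp [hm])
      · refine ⟨a, 1 :: n :: l, ha, by simpa using hl, ?_⟩
        have : bar a = y := by unfold bar; omega
        simp [runs, this]

theorem Diffble.exists_runs {w : Word} (h : Diffble w) :
    ∃ y, (y = 1 ∨ y = 2) ∧ w = runs y (rle w) := by
  obtain ⟨y, l, hy, hl, rfl⟩ := CinftyWords.exists_runs h.1
  exact ⟨y, hy, by rw [rle_runs hy hl]⟩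

theorem diffble_runs {y : ℕ} (hy : y = 1 ∨ y = 2) {l : Word} (h : IsWord l) :
    Diffble (runs y l) :=
  ⟨isWord_runs hy l, by rwa [rle_runs hy h.pos]⟩

theorem runs_append {y : ℕ} (hy : y = 1 ∨ y = 2) (l : Word) :
    ∃ z, (z = 1 ∨ z = 2) ∧ ∀ m, runs y (l ++ m) = runs y l ++ runs z m := by
  induction l generalizing y with
  | nil => exact ⟨y, hy, fun m => rfl⟩
  | cons n l ih =>
    obtain ⟨z, hz, h⟩ := ih (bar_letter hy)
    exact ⟨z, hz, fun m => by simp [runs, h]⟩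

theorem reverse_runs_concat {y : ℕ} (hy : y = 1 ∨ y = 2) (l : Word) :
    ∃ z, (z = 1 ∨ z = 2) ∧
      ∀ n, (runs y (l ++ [n])).reverse = runs z (n :: l.reverse) := by
  induction l using List.reverseRecOn with
  | nil => exact ⟨y, hy, fun n => by simp [runs]⟩
  | append_singleton l m ih =>
    obtain ⟨z, hz, h⟩ := ih
    obtain ⟨t, ht, happ⟩ := runs_append hy l
    obtain rfl : t = z := by
      have h1 := h 1
      simp [happ, runs] at h1
      exact h1.1
    refine ⟨bar t, bar_letter ht, fun n => ?_⟩
    have h2 := h m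
    rw [happ, List.reverse_append] at h2
    rw [List.append_assoc, happ]
    simp only [List.cons_append, List.nil_append, List.reverse_append, List.reverse_cons,
      List.reverse_nil]
    rw [runs.eq_2 (bar t), bar_bar ht, ← h2]
    simp [runs]

theorem reverse_runs {y : ℕ} (hy : y = 1 ∨ y = 2) (l : Word) :
    ∃ z, (z = 1 ∨ z = 2) ∧ (runs y l).reverse = runs z l.reverse := by
  rcases List.eq_nil_or_concat l with rfl | ⟨l, n, rfl⟩
  · exact ⟨y, hy, rfl⟩
  · obtain ⟨z, hz, h⟩ := reverse_runs_concat hy l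
    exact ⟨z, hz, by simpa using h n⟩

theorem rle_reverse {w : Word} (h : IsWord w) : rle w.reverse = (rle w).reverse := by
  obtain ⟨y, l, hy, hl, rfl⟩ := exists_runs h
  obtain ⟨z, hz, hr⟩ := reverse_runs hy l
  rw [hr, rle_runs hz (by simpa using hl), rle_runs hy hl]

theorem IsWord.reverse {w : Word} (h : IsWord w) : IsWord w.reverse := by
  simpa [IsWord] using h

theorem Diffble.reverse {w : Word} (h : Diffble w) : Diffble w.reverse :=
  ⟨h.1.reverse, by rw [rle_reverse h.1]; exact h.2.reverse⟩

/-! ### The derivative as a trimmed run-length encoding -/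

theorem map_length_dropFirstRun1 (g : List (List ℕ)) :
    (dropFirstRun1 g).map List.length = trimLeft (g.map List.length) := by
  cases g with
  | nil => rfl
  | cons r g => by_cases h : r.length = 1 <;> simp [dropFirstRun1, trimLeft, h]

theorem D_eq_trim (w : Word) : D w = (trimLeft (trimLeft (rle w)).reverse).reverse := by
  simp only [D, rle, List.map_reverse, map_length_dropFirstRun1]

theorem trimLeft_append_of_ne_nil {l : Word} (hl : l ≠ []) (m : Word) :
    trimLeft (l ++ m) = trimLeft l ++ m := by
  cases l with
  | nil => contradiction
  | cons n l => by_cases h : n = 1 <;> simp [trimLeft, h]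

theorem trim_comm (l : Word) :
    (trimLeft (trimLeft l).reverse).reverse = trimLeft (trimLeft l.reverse).reverse := by
  rcases l with _ | ⟨a, l⟩
  · rfl
  rcases List.eq_nil_or_concat l with rfl | ⟨l, b, rfl⟩
  · by_cases ha : a = 1 <;> simp [trimLeft, ha]
  · by_cases ha : a = 1 <;> by_cases hb : b = 1 <;> simp [trimLeft, ha, hb]

theorem D_reverse {w : Word} (h : IsWord w) : D w.reverse = (D w).reverse := by
  rw [D_eq_trim, D_eq_trim, rle_reverse h, trim_comm, List.reverse_reverse]
  simp [trim_comm]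

theorem IsWord.trimLeft {l : Word} (h : IsWord l) : IsWord (trimLeft l) := by
  cases l with
  | nil => exact h
  | cons n l =>
    intro x hx
    apply h
    by_cases hn : n = 1 <;> simp [CinftyWords.trimLeft, hn] at hx ⊢ <;> tauto

theorem Diffble.isWord_D {w : Word} (h : Diffble w) : IsWord (D w) := by
  rw [D_eq_trim]; exact h.2.trimLeft.reverse.trimLeft.reverse

/-- `A` is an admissible run-length prefix of a primitive of a word starting like `u`: a single
run of length one, which may only be absent when `u` starts with `2`. -/
def Edge (A u : Word) : Prop := A = [1] ∨ A = [] ∧ u.getD 0 0 = 2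

theorem Edge.isWord {A u : Word} (h : Edge A u) : IsWord A := by
  rcases h with rfl | ⟨rfl, -⟩ <;> simp [IsWord]

theorem Edge.reverse_eq {A u : Word} (h : Edge A u) : A.reverse = A := by
  rcases h with rfl | ⟨rfl, -⟩ <;> rfl

theorem Edge.trimLeft_append {A u : Word} (h : Edge A u) (m : Word) (hu : u ≠ []) :
    trimLeft (A ++ u ++ m) = u ++ m := by
  rcases h with rfl | ⟨rfl, h⟩
  · simp [trimLeft]
  · cases u with
    | nil => contradiction
    | cons n u => simp at h; simp [trimLeft, h]

theorem exists_edge {l : Word} (hl : IsWord l) : ∃ A, Edge A (trimLeft l) ∧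
    (l ≠ [] → l = A ++ trimLeft l) := by
  cases l with
  | nil => exact ⟨[1], .inl rfl, by simp⟩
  | cons n l =>
    by_cases hn : n = 1
    · exact ⟨[1], .inl rfl, by simp [trimLeft, hn]⟩
    · refine ⟨[], .inr ⟨rfl, ?_⟩, by simp [trimLeft, hn]⟩
      have := hl n (by simp)
      simp [trimLeft, hn]; omega

theorem Edge.of_prefix {A u v : Word} (h : Edge A v) (hu : u ≠ []) (huv : u <+: v) :
    Edge A u := by
  obtain ⟨t, rfl⟩ := huv
  cases u with
  | nil => contradiction
  | cons n u => simpa [Edge] using h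

theorem Edge.append {A u : Word} (h : Edge A u) (hu : u ≠ []) (m : Word) : Edge A (u ++ m) := by
  cases u with
  | nil => contradiction
  | cons n u => simpa [Edge] using h

theorem Diffble.exists_decomp {w : Word} (h : Diffble w) (hD : D w ≠ []) :
    ∃ y A B, (y = 1 ∨ y = 2) ∧ Edge A (D w) ∧ Edge B (D w).reverse ∧
      w = runs y (A ++ D w ++ B) := by
  obtain ⟨y, hy, hw⟩ := h.exists_runs
  obtain ⟨A, hA, hlA⟩ := exists_edge h.2
  obtain ⟨B, hB, hlB⟩ := exists_edge h.2.trimLeft.reverse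
  have hr : trimLeft (rle w) ≠ [] := by
    intro h0; apply hD; rw [D_eq_trim, h0]; rfl
  have hr' : rle w ≠ [] := by intro h0; apply hr; rw [h0]; rfl
  have e : trimLeft (rle w) = D w ++ B := by
    have := congrArg List.reverse (hlB (by simpa using hr))
    rwa [List.reverse_reverse, List.reverse_append, hB.reverse_eq, ← D_eq_trim] at this
  refine ⟨y, A, B, hy, hA.of_prefix hD (e ▸ List.prefix_append _ _), ?_, ?_⟩
  · rwa [D_eq_trim, List.reverse_reverse]
  · rw [List.append_assoc, ← e, ← hlA hr']; exact hw

theorem D_runs {y : ℕ} (hy : y = 1 ∨ y = 2) {A u B : Word} (hu : IsWord u) (hu0 : u ≠ [])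
    (hA : Edge A u) (hB : Edge B u.reverse) :
    IsPrimitive (runs y (A ++ u ++ B)) u := by
  have hl : IsWord (A ++ u ++ B) := by
    intro x hx
    rcases List.mem_append.1 hx with hx | hx
    · rcases List.mem_append.1 hx with hx | hx
      · exact hA.isWord x hx
      · exact hu x hx
    · exact hB.isWord x hx
  refine ⟨diffble_runs hy hl, ?_⟩
  rw [D_eq_trim, rle_runs hy hl.pos, hA.trimLeft_append _ hu0, List.reverse_append,
    hB.reverse_eq]
  have := hB.trimLeft_append [] (by simpa using hu0)
  simp only [List.append_nil] at this
  rw [this, List.reverse_reverse]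

/-! ### Optimal primitives and their ends -/

/-- `w` is a primitive of `D w` of maximal length (`s = true`) or minimal length
(`s = false`). -/
def Opt (s : Bool) (w : Word) : Prop :=
  ∀ v, IsPrimitive v (D w) → if s then v.length ≤ w.length else w.length ≤ v.length

/-- The local condition at the left end of `w` under which it is as long (`s = true`) or as short
(`s = false`) as possible on the left among the primitives of `D w`. -/
def LeftOpt (s : Bool) (w : Word) : Prop :=
  (D w).getD 0 0 = 2 → (w.getD 0 0 ≠ w.getD 1 0 ↔ s = true)

/-- The counterpart of `LeftOpt` for an edge `A` of a word starting like `u`. -/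
def EdgeOpt (s : Bool) (A u : Word) : Prop := u.getD 0 0 = 2 → (A = [1] ↔ s = true)

theorem leftOpt_runs {s : Bool} {y : ℕ} (hy : y = 1 ∨ y = 2) {A u B : Word} (hu : IsWord u)
    (hu0 : u ≠ []) (hA : Edge A u) (hB : Edge B u.reverse) :
    LeftOpt s (runs y (A ++ u ++ B)) ↔ EdgeOpt s A u := by
  unfold LeftOpt EdgeOpt
  rw [(D_runs hy hu hu0 hA hB).2]
  obtain ⟨n, u, rfl⟩ := List.exists_cons_of_ne_nil hu0
  refine imp_congr_right fun h2 => iff_congr ?_ Iff.rfl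
  simp only [List.getD_cons_zero] at h2
  subst h2
  rcases hA with rfl | ⟨rfl, -⟩
  · simpa [runs, List.replicate_succ] using (bar_ne y).symm
  · simp [runs, List.replicate_succ]

theorem exists_edgeOpt (s : Bool) {u : Word} (hu : IsWord u) (hu0 : u ≠ []) :
    ∃ A, Edge A u ∧ EdgeOpt s A u := by
  obtain ⟨n, u, rfl⟩ := List.exists_cons_of_ne_nil hu0
  have hn := hu n (by simp)
  by_cases h : s = true ∨ n = 1
  · exact ⟨[1], .inl rfl, fun h2 => by simp at h2; subst h2; simpa using h⟩
  · exact ⟨[], .inr ⟨rfl, by simp; omega⟩, fun _ => by cases s <;> simp_all⟩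

theorem EdgeOpt.sum_le {s : Bool} {A A' u : Word} (h : EdgeOpt s A u) (hA : Edge A u)
    (hA' : Edge A' u) : if s then A'.sum ≤ A.sum else A.sum ≤ A'.sum := by
  rcases hA with rfl | ⟨rfl, h1⟩ <;> rcases hA' with rfl | ⟨rfl, h2⟩ <;> cases s <;>
    simp_all [EdgeOpt]

theorem EdgeOpt.of_sum_le {s : Bool} {A A' u : Word} (h : EdgeOpt s A' u) (hA : Edge A u)
    (hA' : Edge A' u) (hs : if s then A'.sum ≤ A.sum else A.sum ≤ A'.sum) : EdgeOpt s A u := by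
  rcases hA with rfl | ⟨rfl, h1⟩ <;> rcases hA' with rfl | ⟨rfl, h2⟩ <;> cases s <;>
    simp_all [EdgeOpt]

theorem opt_runs {s : Bool} {y : ℕ} (hy : y = 1 ∨ y = 2) {A u B : Word} (hu : IsWord u)
    (hu0 : u ≠ []) (hA : Edge A u) (hB : Edge B u.reverse) :
    Opt s (runs y (A ++ u ++ B)) ↔ EdgeOpt s A u ∧ EdgeOpt s B u.reverse := by
  unfold Opt
  rw [(D_runs hy hu hu0 hA hB).2]
  constructor
  · intro h
    obtain ⟨A', hA', hoA⟩ := exists_edgeOpt s hu hu0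
    obtain ⟨B', hB', hoB⟩ := exists_edgeOpt s hu.reverse (by simpa using hu0)
    have h1 := h _ (D_runs hy hu hu0 hA' hB)
    have h2 := h _ (D_runs hy hu hu0 hA hB')
    simp only [length_runs, List.sum_append] at h1 h2
    refine ⟨hoA.of_sum_le hA hA' ?_, hoB.of_sum_le hB hB' ?_⟩ <;>
      cases s <;> simp at * <;> omega
  · rintro ⟨h1, h2⟩ v ⟨hv, rfl⟩
    obtain ⟨z, A', B', hz, hA', hB', e⟩ := hv.exists_decomp hu0
    have hA1 := h1.sum_le hA hA'
    have hB1 := h2.sum_le hB hB'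
    have hlen := congrArg List.length e
    simp only [length_runs, List.sum_append] at hlen ⊢
    cases s <;> simp at * <;> omega

theorem Diffble.opt_leftOpt {s : Bool} {w : Word} (h : Diffble w) (hD : D w ≠ [])
    (ho : Opt s w) : LeftOpt s w := by
  obtain ⟨y, A, B, hy, hA, hB, e⟩ := h.exists_decomp hD
  rw [e] at ho ⊢
  rw [leftOpt_runs hy h.isWord_D hD hA hB]
  exact ((opt_runs hy h.isWord_D hD hA hB).1 ho).1

theorem opt_reverse {s : Bool} {w : Word} (h : IsWord w) (ho : Opt s w) : Opt s w.reverse := by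
  intro v hv
  have := ho v.reverse ⟨hv.1.reverse, by rw [D_reverse hv.1.1, hv.2, D_reverse h,
    List.reverse_reverse]⟩
  simpa using this

/-! ### Prefixes -/

theorem trimLeft_prefix {u v : Word} (h : u <+: v) (hu : u ≠ []) :
    trimLeft u <+: trimLeft v := by
  obtain ⟨t, rfl⟩ := h
  rw [trimLeft_append_of_ne_nil hu]
  exact List.prefix_append _ _

theorem runs_prefix {y z : ℕ} (hy : y = 1 ∨ y = 2) (hz : z = 1 ∨ z = 2) {l m : Word}
    (hl : IsWord l) (hm : IsWord m) (h : runs y l <+: runs z m) :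
    (trimLeft l.reverse).reverse <+: (trimLeft m.reverse).reverse := by
  induction l generalizing y z m with
  | nil => exact List.nil_prefix
  | cons n l ih =>
    cases m with
    | nil =>
      have := h.length_le
      have := hl.pos n (by simp)
      simp [length_runs] at *
      omega
    | cons k m =>
      have hn := hl n (by simp)
      have hk := hm k (by simp)
      have hl' : IsWord l := fun x hx => hl x (by simp [hx])
      have hm' : IsWord m := fun x hx => hm x (by simp [hx])
      have hyz : y = z := by
        rcases hn with rfl | rfl <;> rcases hk with rfl | rfl <;>
          simp [runs, List.replicate_succ] at h <;> tauto
      subst hyz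
      rcases List.eq_nil_or_concat l with rfl | ⟨l', a, rfl⟩
      · rcases hn with rfl | rfl
        · simp [trimLeft]
        · have : k = 2 := by
            rcases hk with rfl | rfl
            · exfalso
              simp only [runs, List.replicate_succ, List.replicate_zero, List.append_nil,
                List.cons_append, List.nil_append] at h
              rw [List.cons_prefix_cons] at h
              obtain ⟨t, ht⟩ := h.2
              exact bar_ne y (head?_runs (x := y) hm'.pos (by rw [← ht]; simp)).symm
            · rfl
          subst this
          rcases List.eq_nil_or_concat m with rfl | ⟨m', b, rfl⟩
          · simp
          · by_cases hb : b = 1 <;> simp [trimLeft, hb]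
      · have hnk : n = k ∧ runs (bar y) (l' ++ [a]) <+: runs (bar y) m := by
          have e : ∀ j, runs y (1 :: j) = y :: runs (bar y) j := fun j => rfl
          have e2 : ∀ j, runs y (2 :: j) = y :: y :: runs (bar y) j := fun j => rfl
          have hne : ∀ (j : Word) t, IsWord j → ¬ (y :: t <+: runs (bar y) j) := by
            rintro j t hj ⟨r, hr⟩
            exact bar_ne y (head?_runs (x := y) hj.pos (by rw [← hr]; simp)).symm
          have hne' : ∀ t, ¬ (runs (bar y) (l' ++ [a]) <+: y :: t) := by
            rintro t ⟨r, hr⟩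
            obtain ⟨b, c, hbc⟩ : ∃ b c, runs (bar y) (l' ++ [a]) = b :: c := by
              apply List.exists_cons_of_ne_nil
              intro h0
              have := congrArg List.length h0
              have := hl'.pos a (by simp)
              simp [length_runs] at *
              omega
            have hb := head?_runs (x := b) hl'.pos (y := bar y) (by simp [hbc])
            rw [hbc] at hr
            simp at hr
            exact bar_ne y (hb ▸ hr.1)
          simp only [List.concat_eq_append] at h hl' hne hne'
          rcases hn with rfl | rfl <;> rcases hk with rfl | rfl <;>
            simp only [e, e2, List.cons_prefix_cons, true_and] at h
          · exact ⟨rfl, h⟩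
          · exact absurd h (hne' _)
          · exact absurd h (hne _ _ hm')
          · exact ⟨rfl, h⟩
        obtain ⟨rfl, hp⟩ := hnk
        have := ih (bar_letter hy) (bar_letter hy) hl' hm' (by simpa using hp)
        have hm0 : m ≠ [] := by
          rintro rfl
          have := hp.length_le
          have := hl'.pos a (by simp)
          simp [length_runs] at *
          omega
        rw [List.reverse_cons, List.reverse_cons, trimLeft_append_of_ne_nil (by simp),
          trimLeft_append_of_ne_nil (by simpa using hm0)]
        simpa using this

theorem D_prefix {w v : Word} (hw : Diffble w) (hv : Diffble v) (h : w <+: v) :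
    D w <+: D v := by
  obtain ⟨y, hy, ew⟩ := hw.exists_runs
  obtain ⟨z, hz, ev⟩ := hv.exists_runs
  rw [ew, ev] at h
  have := runs_prefix hy hz hw.2 hv.2 h
  rw [D_eq_trim, D_eq_trim, trim_comm, trim_comm]
  by_cases h0 : (trimLeft (rle w).reverse).reverse = []
  · rw [h0]; exact List.nil_prefix
  · exact trimLeft_prefix this h0

theorem length_of_D_ne_nil {w : Word} (hw : Diffble w) (h : D w ≠ []) : 2 ≤ w.length := by
  obtain ⟨y, A, B, hy, hA, hB, e⟩ := hw.exists_decomp h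
  have hlen := congrArg List.length e
  rw [length_runs] at hlen
  obtain ⟨n, u, hu⟩ := List.exists_cons_of_ne_nil h
  have hn : n = 1 ∨ n = 2 := hw.isWord_D n (by simp [hu])
  rw [hu] at hlen hA
  rcases hA with rfl | ⟨rfl, h2⟩
  · simp at hlen; omega
  · simp at hlen h2; omega

theorem LeftOpt.of_prefix {s : Bool} {w v : Word} (hw : Diffble w) (hv : Diffble v)
    (h : w <+: v) (hD : D w ≠ []) (ho : LeftOpt s v) : LeftOpt s w := by
  have hlen := length_of_D_ne_nil hw hD
  obtain ⟨t, ht⟩ := D_prefix hw hv h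
  obtain ⟨r, rfl⟩ := h
  match w, hlen with
  | a :: b :: w, _ =>
    obtain ⟨n, u, hu⟩ := List.exists_cons_of_ne_nil hD
    unfold LeftOpt at *
    rw [← ht, hu] at ho
    rw [hu]
    simpa using ho

theorem exists_extension {s : Bool} {w v : Word} (hw : Diffble w) (hv : IsWord v)
    (hD : D w ≠ []) (hp : D w <+: v) (hlt : (D w).length < v.length) (ho : LeftOpt s w) :
    ∃ x, Diffble x ∧ D x = v ∧ Opt s x ∧ w <+: x ∧ w.length < x.length := by
  obtain ⟨y, A, B, hy, hA, hB, e⟩ := hw.exists_decomp hD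
  have hv0 : v ≠ [] := by rintro rfl; simp at hlt
  have hoA : EdgeOpt s A (D w) := by
    rw [e] at ho; exact (leftOpt_runs hy hw.isWord_D hD hA hB).1 ho
  obtain ⟨r, rfl⟩ := hp
  have hr0 : r ≠ [] := by rintro rfl; simp at hlt
  obtain ⟨B', hB', hoB⟩ := exists_edgeOpt s hv.reverse
    fun h0 => hv0 (List.reverse_eq_nil_iff.1 h0)
  have hA' := hA.append hD r
  have hoA' : EdgeOpt s A (D w ++ r) := by
    obtain ⟨n, u, hu⟩ := List.exists_cons_of_ne_nil hD
    rw [hu] at hoA ⊢; simpa [EdgeOpt] using hoA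
  have hprim := D_runs hy hv hv0 hA' hB'
  refine ⟨_, hprim.1, hprim.2, (opt_runs hy hv hv0 hA' hB').2 ⟨hoA', hoB⟩, ?_⟩
  obtain ⟨z, hz, hz'⟩ := runs_append hy (A ++ D w)
  have hsum : 2 ≤ (r ++ B').sum := by
    have hr : IsWord r := fun x hx => hv x (by simp [hx])
    obtain ⟨r, n, rfl⟩ := (List.eq_nil_or_concat r).resolve_left hr0
    have hn := hr n (by simp)
    rcases hB' with rfl | ⟨rfl, h2⟩
    · simp; omega
    · simp at h2; simp; omega
  have hlast : runs z B <+: runs z (r ++ B') ∧ B.sum < (r ++ B').sum := by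
    rcases hB with rfl | ⟨rfl, -⟩
    · refine ⟨?_, by simp at hsum ⊢; omega⟩
      obtain ⟨n, r, rfl⟩ := List.exists_cons_of_ne_nil hr0
      obtain ⟨m, rfl⟩ : ∃ m, n = m + 1 := ⟨n - 1, by have := hv.pos n (by simp); omega⟩
      simp [runs, List.replicate_succ]
    · exact ⟨List.nil_prefix, by simp at *; omega⟩
  have e1 : A ++ (D w ++ r) ++ B' = (A ++ D w) ++ (r ++ B') := by simp
  have e2 : w = runs y (A ++ D w) ++ runs z B := by rw [← hz']; exact e
  rw [e1, hz']
  constructor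
  · conv_lhs => rw [e2]
    exact (List.prefix_append_right_inj _).2 hlast.1
  · conv_lhs => rw [e2]
    simp only [List.length_append, length_runs]
    simp at *
    omega

/-! ### Iterated derivatives and heights -/

theorem mem_Cinf_iff {w : Word} : w ∈ Cinf ↔ ∀ j, Diffble (D^[j] w) := by
  constructor
  · intro h j
    exact (h (j + 1)).2 j (by omega)
  · intro h k
    exact ⟨(h 0).1, fun j _ => h j⟩

theorem D_nil : D [] = [] := rfl

theorem iterate_D_nil (j : ℕ) : D^[j] [] = [] :=
  Function.iterate_fixed D_nil j

theorem length_le_sum {l : Word} (h : IsWord l) : l.length ≤ l.sum := by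
  induction l with
  | nil => simp
  | cons n l ih =>
    have := h.pos n (by simp)
    have := ih fun x hx => h x (by simp [hx])
    simp; omega

theorem length_D_lt {w : Word} (h : Diffble w) (h0 : w ≠ []) : (D w).length < w.length := by
  by_cases hD : D w = []
  · rw [hD]; exact List.length_pos_of_ne_nil h0
  · obtain ⟨y, A, B, hy, hA, hB, e⟩ := h.exists_decomp hD
    have hlen := congrArg List.length e
    rw [length_runs] at hlen
    have hu := h.isWord_D
    obtain ⟨n, u, hn⟩ := List.exists_cons_of_ne_nil hD
    rw [hn] at hlen hA hu ⊢
    have := length_le_sum (l := u) fun x hx => hu x (by simp [hx])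
    have := hu.pos n (by simp)
    rcases hA with rfl | ⟨rfl, h2⟩
    · simp at hlen ⊢; omega
    · simp at hlen h2 ⊢; omega

theorem exists_iterate_D_eq_nil {w : Word} (h : ∀ j, Diffble (D^[j] w)) :
    ∃ k, D^[k] w = [] := by
  induction hn : w.length using Nat.strong_induction_on generalizing w with
  | _ n ih =>
    by_cases h0 : w = []
    · exact ⟨0, h0⟩
    · obtain ⟨k, hk⟩ := ih (D w).length (hn ▸ length_D_lt (h 0) h0)
        (fun j => h (j + 1)) rfl
      exact ⟨k + 1, hk⟩

theorem lt_height_iff {w : Word} (h : ∀ j, Diffble (D^[j] w)) (j : ℕ) :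
    j < height w ↔ D^[j] w ≠ [] := by
  constructor
  · intro hj h0
    exact Nat.notMem_of_lt_sInf hj h0
  · intro hj
    by_contra hlt
    have hmem : D^[height w] w = [] := Nat.sInf_mem (exists_iterate_D_eq_nil h)
    apply hj
    obtain ⟨i, rfl⟩ := Nat.exists_eq_add_of_le (not_lt.1 hlt)
    rw [Nat.add_comm, Function.iterate_add_apply, hmem, iterate_D_nil]

theorem iterate_D_reverse {w : Word} (h : ∀ j, Diffble (D^[j] w)) (j : ℕ) :
    D^[j] w.reverse = (D^[j] w).reverse := by
  induction j with
  | zero => rfl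
  | succ j ih => rw [Function.iterate_succ_apply', ih, D_reverse (h j).1,
      Function.iterate_succ_apply']

theorem iterate_D_prefix {w v : Word} (hw : ∀ j, Diffble (D^[j] w))
    (hv : ∀ j, Diffble (D^[j] v)) (h : w <+: v) (j : ℕ) : D^[j] w <+: D^[j] v := by
  induction j with
  | zero => exact h
  | succ j ih =>
    rw [Function.iterate_succ_apply', Function.iterate_succ_apply']
    exact D_prefix (hw j) (hv j) ih

theorem reverse_mem_Cinf {w : Word} (h : w ∈ Cinf) : w.reverse ∈ Cinf := by
  rw [mem_Cinf_iff] at h ⊢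
  intro j
  rw [iterate_D_reverse h]
  exact (h j).reverse

theorem height_reverse {w : Word} (h : w ∈ Cinf) : height w.reverse = height w := by
  simp only [height, iterate_D_reverse (mem_Cinf_iff.1 h), List.reverse_eq_nil_iff]

/-! ### Extremal words -/

/-- All iterated derivatives of the `C∞`-word `w` are optimal primitives of the next one. -/
def Extremal (s : Bool) (w : Word) : Prop :=
  (∀ j, Diffble (D^[j] w)) ∧ w ≠ [] ∧ ∀ j, D^[j + 1] w ≠ [] → Opt s (D^[j] w)

theorem maximalWord_iff {w : Word} : MaximalWord w ↔ Extremal true w := by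
  unfold MaximalWord Extremal
  rw [mem_Cinf_iff]
  refine and_congr_right fun h => and_congr_right fun _ => forall_congr' fun j => ?_
  rw [← lt_height_iff h]
  simp only [Opt, if_true, ← Function.iterate_succ_apply']
  rfl

theorem minimalWord_iff {w : Word} : MinimalWord w ↔ Extremal false w := by
  unfold MinimalWord Extremal
  rw [mem_Cinf_iff]
  refine and_congr_right fun h => and_congr_right fun _ => forall_congr' fun j => ?_
  rw [← lt_height_iff h]
  simp only [Opt, Bool.false_eq_true, if_false, ← Function.iterate_succ_apply']
  rfl

theorem Extremal.reverse {s : Bool} {w : Word} (h : Extremal s w) : Extremal s w.reverse := by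
  obtain ⟨h1, h2, h3⟩ := h
  refine ⟨fun j => ?_, by simpa using h2, fun j hj => ?_⟩
  · rw [iterate_D_reverse h1]; exact (h1 j).reverse
  · rw [iterate_D_reverse h1] at hj ⊢
    exact opt_reverse (h1 j).1 (h3 j (by simpa using hj))

theorem Extremal.of_D {s : Bool} {w : Word} (hw : Diffble w) (ho : Opt s w)
    (h : Extremal s (D w)) : Extremal s w := by
  refine ⟨fun j => ?_, fun h0 => h.2.1 (by rw [h0, D_nil]), fun j hj => ?_⟩
  · cases j with
    | zero => exact hw
    | succ j => exact h.1 j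
  · cases j with
    | zero => exact ho
    | succ j => exact h.2.2 j hj

theorem extremal_singleton_one (s : Bool) : Extremal s [1] := by
  have h1 : D [1] = [] := by decide
  have hj : ∀ j, D^[j + 1] [1] = [] := fun j => by
    rw [Function.iterate_succ_apply, h1, iterate_D_nil]
  refine ⟨fun j => ?_, by simp, fun j h => absurd (hj j) h⟩
  cases j with
  | zero => exact diffble_runs (y := 1) (.inl rfl) (l := [1]) (by simp [IsWord])
  | succ j => rw [hj]; simp [Diffble, rle, IsWord]

theorem extremal_alternating (s : Bool) {y : ℕ} (hy : y = 1 ∨ y = 2) :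
    Extremal s [y, bar y, y] := by
  have h1 : IsWord [1] := by simp [IsWord]
  have hE : Edge [1] [1] := .inl rfl
  have e : runs y ([1] ++ [1] ++ [1]) = [y, bar y, y] := by simp [runs, bar_bar hy]
  have hp := D_runs hy h1 (by simp) hE (B := [1]) hE
  have ho := (opt_runs (s := s) hy h1 (by simp) hE (B := [1]) hE).2
    ⟨by simp [EdgeOpt], by simp [EdgeOpt]⟩
  rw [e] at hp ho
  exact .of_D hp.1 ho (hp.2 ▸ extremal_singleton_one s)

theorem exists_extremal_of_D_eq_nil (s : Bool) {w : Word} (hw : Diffble w) (h0 : w ≠ [])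
    (hD : D w = []) : ∃ v, Extremal s v ∧ w <+: v ∧ w.length < v.length := by
  obtain ⟨y, hy, e⟩ := hw.exists_runs
  refine ⟨_, extremal_alternating s hy, ?_⟩
  rw [D_eq_trim] at hD
  have hl := hw.2
  generalize rle w = l at *
  subst e
  match l with
  | [] => exact absurd rfl h0
  | [a] =>
    have : a = 1 := by by_contra h; simp [trimLeft, h] at hD
    subst this; simp [runs]
  | [a, b] =>
    have : a = 1 ∧ b = 1 := by
      by_cases ha : a = 1 <;> by_cases hb : b = 1 <;> simp [trimLeft, ha, hb] at hD ⊢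
    obtain ⟨rfl, rfl⟩ := this
    simp [runs]
  | a :: b :: c :: l =>
    exfalso
    obtain ⟨l, d, hd⟩ := (List.eq_nil_or_concat (c :: l)).resolve_left (by simp)
    rw [hd] at hD
    by_cases ha : a = 1 <;> by_cases hb : d = 1 <;> simp [trimLeft, ha, hb] at hD

theorem exists_extremal {s : Bool} {w : Word} (hw : ∀ j, Diffble (D^[j] w)) (h0 : w ≠ [])
    (h : ∀ j, D^[j + 1] w ≠ [] → LeftOpt s (D^[j] w)) :
    ∃ v, Extremal s v ∧ w <+: v ∧ w.length < v.length := by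
  induction hn : w.length using Nat.strong_induction_on generalizing w with
  | _ n ih =>
    by_cases hD : D w = []
    · exact hn ▸ exists_extremal_of_D_eq_nil s (hw 0) h0 hD
    · obtain ⟨v, hv, hp, hlt⟩ := ih (D w).length (hn ▸ length_D_lt (hw 0) h0)
        (fun j => hw (j + 1)) hD (fun j hj => h (j + 1) hj) rfl
      obtain ⟨x, hx, rfl, ho, hpx, hltx⟩ :=
        exists_extension (hw 0) (hv.1 0).1 hD hp hlt (h 0 hD)
      exact ⟨x, .of_D hx ho hv, hpx, hn ▸ hltx⟩

theorem prefix_extremal_iff {s : Bool} {w : Word} (hw : ∀ j, Diffble (D^[j] w)) (h0 : w ≠ []) :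
    (∃ v, Extremal s v ∧ w <+: v) ↔ ∀ j, D^[j + 1] w ≠ [] → LeftOpt s (D^[j] w) := by
  constructor
  · rintro ⟨v, ⟨hv, -, ho⟩, hp⟩ j hj
    have hv0 : D^[j + 1] v ≠ [] := fun h => hj <| by
      simpa [h] using iterate_D_prefix hw hv hp (j + 1)
    have hoj := ho j hv0
    rw [Function.iterate_succ_apply'] at hj hv0
    exact ((hv j).opt_leftOpt hv0 hoj).of_prefix (hw j) (hv j) (iterate_D_prefix hw hv hp j) hj
  · intro h
    obtain ⟨v, hv, hp, -⟩ := exists_extremal hw h0 h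
    exact ⟨v, hv, hp⟩

theorem suffix_extremal_iff {s : Bool} {w : Word} :
    (∃ v, Extremal s v ∧ w <:+ v) ↔ ∃ v, Extremal s v ∧ w.reverse <+: v := by
  constructor
  · rintro ⟨v, hv, h⟩
    exact ⟨v.reverse, hv.reverse, List.reverse_prefix.2 h⟩
  · rintro ⟨v, hv, h⟩
    exact ⟨v.reverse, hv.reverse, List.reverse_prefix.1 (by simpa using h)⟩

/-! ### The frontier -/

theorem psi_getD_succ {w : Word} {i : ℕ} (h : i + 1 < height w) :
    (psi w).getD (i + 1) 0 =
      if (D^[i + 1] w).getD 0 0 = 2 ∧ (D^[i] w).getD 0 0 ≠ (D^[i] w).getD 1 0 then 0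
      else (D^[i + 1] w).getD 0 0 := by
  simp [psi, List.getD_eq_getElem?_getD, List.getElem?_map, List.getElem?_range h]

theorem psi_ne_iff {w : Word} (hw : ∀ j, Diffble (D^[j] w)) (s : Bool) :
    (∀ i, 1 ≤ i → i < height w → (psi w).getD i 0 ≠ if s then 2 else 0) ↔
      ∀ j, D^[j + 1] w ≠ [] → LeftOpt s (D^[j] w) := by
  have key : ∀ j, D^[j + 1] w ≠ [] →
      ((psi w).getD (j + 1) 0 ≠ (if s then 2 else 0) ↔ LeftOpt s (D^[j] w)) := by
    intro j hj
    rw [psi_getD_succ ((lt_height_iff hw _).2 hj), LeftOpt, ← Function.iterate_succ_apply' D j w]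
    obtain ⟨n, u, hu⟩ := List.exists_cons_of_ne_nil hj
    have hn : n = 1 ∨ n = 2 := (hw (j + 1)).1 n (by simp [hu])
    rw [hu]
    by_cases (D^[j] w).getD 0 0 = (D^[j] w).getD 1 0 <;>
      rcases hn with rfl | rfl <;> cases s <;> simp
  constructor
  · intro h j hj
    exact (key j hj).1 (h (j + 1) (by omega) ((lt_height_iff hw _).2 hj))
  · intro h i hi hik
    obtain ⟨j, rfl⟩ : ∃ j, i = j + 1 := ⟨i - 1, by omega⟩
    have hj := (lt_height_iff hw _).1 hik
    exact (key j hj).2 (h j hj)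

theorem prefix_extremal_iff_psi {w : Word} (hw : w ∈ Cinf) (hpos : 0 < height w) (s : Bool) :
    (∃ v, Extremal s v ∧ w <+: v) ↔
      ∀ i, 1 ≤ i → i < height w → (psi w).getD i 0 ≠ if s then 2 else 0 := by
  have hw' := mem_Cinf_iff.1 hw
  rw [psi_ne_iff hw', prefix_extremal_iff hw' ((lt_height_iff hw' 0).1 hpos)]

theorem suffix_extremal_iff_psi {w : Word} (hw : w ∈ Cinf) (hpos : 0 < height w) (s : Bool) :
    (∃ v, Extremal s v ∧ w <:+ v) ↔
      ∀ i, 1 ≤ i → i < height w → (psi w.reverse).getD i 0 ≠ if s then 2 else 0 := by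
  rw [suffix_extremal_iff, prefix_extremal_iff_psi (reverse_mem_Cinf hw)
    (by rwa [height_reverse hw]), height_reverse hw]

end CinftyWords

open CinftyWords in
/-- For a C∞-word `w` of height `k > 0` with left frontier `U = Ψ(w)` and right
frontier `V = Ψ(w̃)`: `w` is left maximal iff `U[i] ≠ 2` for `1 ≤ i ≤ k-1`; `w` is left
minimal iff `U[i] ≠ 0` for `1 ≤ i ≤ k-1`; `w` is right maximal iff `V[i] ≠ 2` for
`1 ≤ i ≤ k-1`; `w` is right minimal iff `V[i] ≠ 0` for `1 ≤ i ≤ k-1`. -/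
theorem frontier_characterizes_extremality (w : Word) (hw : w ∈ Cinf)
    (k : ℕ) (hk : height w = k) (hkpos : 0 < k) :
    (LeftMaximal w ↔ ∀ i, 1 ≤ i → i < k → (psi w).getD i 0 ≠ 2) ∧
    (LeftMinimal w ↔ ∀ i, 1 ≤ i → i < k → (psi w).getD i 0 ≠ 0) ∧
    (RightMaximal w ↔ ∀ i, 1 ≤ i → i < k → (psi w.reverse).getD i 0 ≠ 2) ∧
    (RightMinimal w ↔ ∀ i, 1 ≤ i → i < k → (psi w.reverse).getD i 0 ≠ 0) := by
  subst hk
  simp only [LeftMaximal, LeftMinimal, RightMaximal, RightMinimal, maximalWord_iff,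
    minimalWord_iff]
  exact ⟨by simpa using prefix_extremal_iff_psi hw hkpos true,
    by simpa using prefix_extremal_iff_psi hw hkpos false,
    by simpa using suffix_extremal_iff_psi hw hkpos true,
    by simpa using suffix_extremal_iff_psi hw hkpos false⟩
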